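/- arXiv:1910.05669 — 2 statements merged into one kernel-verified Lean document; each statement's English description precedes it below -/
import Mathlib

section
/- Let 𝔤 ⊆ E be a linear subspace with orthogonal complement 𝔤ᗮ and orthogonal projections P∥, P⊥ onto 𝔤, 𝔤ᗮ. Let H : E → E be self-adjoint with H·v = 0 for v ∈ 𝔤, H(𝔤ᗮ) ⊆ 𝔤ᗮ, and λ_min‖y‖² ≤ ⟨H·y, y⟩ ≤ λ_max‖y‖² for all y ∈ 𝔤ᗮ with 0 < λ_min ≤ λ_max. Let α > 0 and let g₀ : ℝ → E be differentiable with g₀(t) invertible, c₁·I ≼ g₀(t)·g₀(t)ᵀ ≼ c₂·I (0 < c₁ ≤ c₂), g₀'(t) = g₀(t)·ξ₀(t) with ξ₀(t) ∈ 𝔤, and g₀(t)·v·g₀(t)⁻¹ ∈ 𝔤 for all v ∈ 𝔤 and all t. Let Kp, Kd ∈ E be such that the 2n×2n real block matrix [[0, I],[Kp, Kd]] is Hurwitz (every eigenvalue has negative real part). Let A : ℝ → (𝔤 → 𝔤) be a family of linear maps, and suppose e⊥ : ℝ → 𝔤ᗮ, e∥ : ℝ → 𝔤, ξ̃ : ℝ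 → 𝔤 are differentiable and satisfy: e⊥'(t) = −α·P⊥((H·e⊥(t))·(g₀(t)·g₀(t)ᵀ)⁻¹); e∥'(t) = g₀(t)·ξ̃(t)·g₀(t)⁻¹ + W(t); ξ̃'(t) = A(t)·ξ̃(t) + v(t), where W(t) = −α·P∥((H·e⊥(t))·(g₀(t)·g₀(t)ᵀ)⁻¹) is differentiable, v(t) = ξ̃(t)·ξ₀(t) − ξ₀(t)·ξ̃(t) + Y(t) − A(t)·ξ̃(t), and Y(t) = g₀(t)⁻¹·(−W'(t) + Kp·e∥(t) + Kd·(g₀(t)·ξ̃(t)·g₀(t)⁻¹ + W(t)))·g₀(t). Then (e⊥, e∥, ξ̃) converges exponentially to zero: there exist C > 0 and β > 0 such that ‖e⊥(t)‖ + ‖e∥(t)‖ + ‖ξ̃(t)‖ ≤ C·e^{−β·t}·(‖e⊥(0)‖ + ‖e∥(0)‖ + ‖ξ̃(0)‖) for all t ≥ 0. -/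
open scoped Matrix

attribute [local instance] Matrix.frobeniusNormedAddCommGroup Matrix.frobeniusNormedSpace

/-- The Frobenius inner product `⟨A, B⟩ = trace (Aᵀ B)` on real `n × n` matrices. -/
def fip {n : ℕ} (A B : Matrix (Fin n) (Fin n) ℝ) : ℝ := (Aᵀ * B).trace

/-- The orthogonal complement of a subspace of real `n × n` matrices with respect to the
Frobenius inner product. -/
def mperp {n : ℕ} (g : Submodule ℝ (Matrix (Fin n) (Fin n) ℝ)) :
    Submodule ℝ (Matrix (Fin n) (Fin n) ℝ) where
  carrier := {y | ∀ v ∈ g, fip v y = 0}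
  add_mem' := by
    intro a b ha hb v hv
    have ha' := ha v hv
    have hb' := hb v hv
    simp only [fip] at *
    rw [Matrix.mul_add, Matrix.trace_add, ha', hb', add_zero]
  zero_mem' := by
    intro v hv
    simp [fip]
  smul_mem' := by
    intro c a ha v hv
    have ha' := ha v hv
    simp only [fip] at *
    rw [Matrix.mul_smul, Matrix.trace_smul, ha', smul_zero]

/-- The real function `f` is bounded on `[0, ∞)` by a decaying exponential times `N`. -/
def ExpDecay (N : ℝ) (f : ℝ → ℝ) : Prop :=
  ∃ C ≥ (0 : ℝ), ∃ β > (0 : ℝ), ∀ t : ℝ, 0 ≤ t → f t ≤ C * Real.exp (-β * t) * N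

namespace ExpDecay

variable {N : ℝ} {f g : ℝ → ℝ}

theorem mono (hg : ExpDecay N g) (h : ∀ t, 0 ≤ t → f t ≤ g t) : ExpDecay N f := by
  obtain ⟨C, hC, β, hβ, hb⟩ := hg
  exact ⟨C, hC, β, hβ, fun t ht => (h t ht).trans (hb t ht)⟩

theorem const_mul (hg : ExpDecay N g) {c : ℝ} (hc : 0 ≤ c) : ExpDecay N fun t => c * g t := by
  obtain ⟨C, hC, β, hβ, hb⟩ := hg
  refine ⟨c * C, by positivity, β, hβ, fun t ht => ?_⟩
  have := mul_le_mul_of_nonneg_left (hb t ht) hc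
  linarith

theorem of_le {M : ℝ} (hf : ExpDecay M f) (hMN : M ≤ N) : ExpDecay N f := by
  obtain ⟨C, hC, β, hβ, hb⟩ := hf
  exact ⟨C, hC, β, hβ, fun t ht => (hb t ht).trans (by gcongr)⟩

theorem exists_rate_lt (hN : 0 ≤ N) (hf : ExpDecay N f) {a : ℝ} (ha : 0 < a) :
    ∃ C ≥ (0 : ℝ), ∃ β > (0 : ℝ), β < a ∧
      ∀ t : ℝ, 0 ≤ t → f t ≤ C * Real.exp (-β * t) * N := by
  obtain ⟨C, hC, β, hβ, hb⟩ := hf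
  refine ⟨C, hC, min β (a / 2), by positivity, (min_le_right _ _).trans_lt (by linarith),
    fun t ht => (hb t ht).trans ?_⟩
  have := min_le_left β (a / 2)
  gcongr

theorem add (hN : 0 ≤ N) (hf : ExpDecay N f) (hg : ExpDecay N g) :
    ExpDecay N fun t => f t + g t := by
  obtain ⟨C, hC, β, hβ, hb⟩ := hf
  obtain ⟨D, hD, γ, hγ, hc⟩ := hg
  refine ⟨C + D, by positivity, min β γ, by positivity, fun t ht => ?_⟩
  have h₁ : C * Real.exp (-β * t) * N ≤ C * Real.exp (-(min β γ) * t) * N := by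
    have := min_le_left β γ
    gcongr
  have h₂ : D * Real.exp (-γ * t) * N ≤ D * Real.exp (-(min β γ) * t) * N := by
    have := min_le_right β γ
    gcongr
  linarith [hb t ht, hc t ht]

end ExpDecay

/-- A stable scalar first-order equation driven by an exponentially decaying input has an
exponentially decaying solution. -/
theorem expDecay_of_hasDerivAt_smul_add {F : Type*} [NormedAddCommGroup F] [NormedSpace ℂ F]
    [NormedSpace ℝ F] [IsScalarTower ℝ ℂ F]
    {N c : ℝ} (hN : 0 ≤ N) (hc : 0 ≤ c) {μ : ℂ} (hμ : μ.re < 0) {u f : ℝ → F}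
    (hu : ∀ t, HasDerivAt u (μ • u t + f t) t) (hf : ExpDecay N fun t => ‖f t‖)
    (h0 : ‖u 0‖ ≤ c * N) : ExpDecay N fun t => ‖u t‖ := by
  obtain ⟨C, hC, β, hβ, hβμ, hb⟩ := hf.exists_rate_lt hN (neg_pos.mpr hμ)
  have hδ : 0 < -μ.re - β := by linarith
  set δ := -μ.re - β with hδ_def
  have hexp : ∀ t : ℝ, HasDerivAt (fun s : ℝ => Complex.exp (-μ * s))
      (Complex.exp (-μ * t) * -μ) t := by
    intro t
    have h := ((hasDerivAt_id t).ofReal_comp.const_mul (-μ)).cexp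
    simpa using h
  have hq : ∀ t : ℝ, HasDerivAt (fun s : ℝ => Complex.exp (-μ * s) • u s)
      (Complex.exp (-μ * t) • f t) t := by
    intro t
    refine HasDerivAt.congr_deriv ((hexp t).smul (hu t)) ?_
    rw [smul_add, smul_smul, mul_neg, neg_smul]
    abel
  have hnorm : ∀ t : ℝ, ‖Complex.exp (-μ * t)‖ = Real.exp (-μ.re * t) := by
    intro t
    simp [Complex.norm_exp]
  have hB : ∀ t : ℝ, HasDerivAt (fun s : ℝ => c * N + C * N / δ * Real.exp (δ * s))
      (C * N * Real.exp (δ * t)) t := by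
    intro t
    have h := ((((hasDerivAt_id t).const_mul δ).exp).const_mul (C * N / δ)).const_add (c * N)
    refine HasDerivAt.congr_deriv h ?_
    simp only [id, mul_one]
    field_simp
  have key : ∀ t : ℝ, 0 ≤ t →
      ‖Complex.exp (-μ * t) • u t‖ ≤ c * N + C * N / δ * Real.exp (δ * t) := by
    intro t ht
    refine image_norm_le_of_norm_deriv_right_le_deriv_boundary
      (f' := fun s : ℝ => Complex.exp (-μ * s) • f s)
      (B' := fun s : ℝ => C * N * Real.exp (δ * s)) (a := 0) (b := t)
      (fun s _ => (hq s).continuousAt.continuousWithinAt)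
      (fun s _ => (hq s).hasDerivWithinAt) ?_ hB ?_ ⟨ht, le_rfl⟩
    · have : 0 ≤ C * N / δ := by positivity
      simp
      linarith
    · intro s hs
      rw [norm_smul, hnorm]
      have h := mul_le_mul_of_nonneg_left (hb s hs.1) (Real.exp_pos (-μ.re * s)).le
      refine h.trans (le_of_eq ?_)
      have : Real.exp (δ * s) = Real.exp (-μ.re * s) * Real.exp (-β * s) := by
        rw [← Real.exp_add]
        congr 1
        rw [hδ_def]
        ring
      rw [this]
      ring
  refine ⟨c + C / δ, by positivity, β, hβ, fun t ht => ?_⟩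
  have h := key t ht
  rw [norm_smul, hnorm] at h
  have hone : 1 ≤ Real.exp (δ * t) := Real.one_le_exp (by positivity)
  have hcN : c * N ≤ c * N * Real.exp (δ * t) := le_mul_of_one_le_right (by positivity) hone
  have hsplit : Real.exp (δ * t) = Real.exp (-μ.re * t) * Real.exp (-β * t) := by
    rw [← Real.exp_add]
    congr 1
    rw [hδ_def]
    ring
  refine le_of_mul_le_mul_left ?_ (Real.exp_pos (-μ.re * t))
  calc _ ≤ c * N + C * N / δ * Real.exp (δ * t) := h
    _ ≤ c * N * Real.exp (δ * t) + C * N / δ * Real.exp (δ * t) := by linarith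
    _ = _ := by rw [hsplit]; ring

section MatrixODE

variable {m k : Type*} [Fintype m] [Fintype k]

theorem HasDerivAt.const_matrix_mul {z : ℝ → Matrix m k ℂ} {z' : Matrix m k ℂ} {t : ℝ}
    (B : Matrix m m ℂ) (hz : HasDerivAt z z' t) : HasDerivAt (fun s => B * z s) (B * z') t := by
  let Lc : Matrix m k ℂ →L[ℝ] Matrix m k ℂ :=
    LinearMap.toContinuousLinearMap
      { toFun := fun x => B * x
        map_add' := Matrix.mul_add B
        map_smul' := fun c x => Matrix.mul_smul B c x }
  exact Lc.hasFDerivAt.comp_hasDerivAt t hz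

variable [DecidableEq m]

theorem expDecay_of_list_prod_mul {N c : ℝ} (hN : 0 ≤ N) (hc : 0 ≤ c) (B : Matrix m m ℂ)
    {z : ℝ → Matrix m k ℂ} (hz : ∀ t, HasDerivAt z (B * z t) t) (h0 : ‖z 0‖ ≤ c * N)
    (l : List ℂ) (hl : ∀ μ ∈ l, μ.re < 0)
    (hprod : ExpDecay N fun t => ‖(l.map fun μ => B - μ • (1 : Matrix m m ℂ)).prod * z t‖) :
    ExpDecay N fun t => ‖z t‖ := by
  induction l with
  | nil => simpa using hprod
  | cons μ l ih =>
    refine ih (fun ν hν => hl ν (List.mem_cons_of_mem _ hν)) ?_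
    set P := (l.map fun μ => B - μ • (1 : Matrix m m ℂ)).prod with hP
    have hcomm : B * P = P * B := by
      refine (Commute.list_prod_right _ _ fun x hx => ?_ : Commute B P)
      obtain ⟨ν, -, rfl⟩ := List.mem_map.mp hx
      exact (Commute.refl B).sub_right ((Commute.one_right B).smul_right ν)
    simp only [List.map_cons, List.prod_cons, ← hP] at hprod
    refine expDecay_of_hasDerivAt_smul_add (c := ‖P‖ * c) hN (by positivity)
      (hl μ List.mem_cons_self) (fun t => ?_) hprod ?_
    · refine HasDerivAt.congr_deriv (HasDerivAt.const_matrix_mul P (hz t)) ?_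
      rw [← Matrix.mul_assoc, ← hcomm, sub_mul, smul_mul_assoc, one_mul, Matrix.sub_mul,
        Matrix.smul_mul]
      abel
    · calc ‖P * z 0‖ ≤ ‖P‖ * ‖z 0‖ := Matrix.frobenius_norm_mul _ _
        _ ≤ ‖P‖ * (c * N) := by gcongr
        _ = _ := by ring

/-- Solutions of `z' = B z` decay exponentially when `B` is Hurwitz. -/
theorem expDecay_of_hurwitz {N c : ℝ} (hN : 0 ≤ N) (hc : 0 ≤ c) (B : Matrix m m ℂ)
    (hB : ∀ μ : ℂ, B.charpoly.IsRoot μ → μ.re < 0)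
    {z : ℝ → Matrix m k ℂ} (hz : ∀ t, HasDerivAt z (B * z t) t) (h0 : ‖z 0‖ ≤ c * N) :
    ExpDecay N fun t => ‖z t‖ := by
  refine expDecay_of_list_prod_mul hN hc B hz h0 B.charpoly.roots.toList
    (fun μ hμ => hB μ (Polynomial.isRoot_of_mem_roots (Multiset.mem_toList.mp hμ))) ?_
  have hsplit := (IsAlgClosed.splits B.charpoly).eq_prod_roots_of_monic B.charpoly_monic
  have hzero : (B.charpoly.roots.toList.map fun μ => B - μ • (1 : Matrix m m ℂ)).prod = 0 := by
    have h := congrArg (Polynomial.aeval B) hsplit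
    rw [Matrix.aeval_self_charpoly] at h
    rw [h, ← Multiset.coe_toList B.charpoly.roots, Multiset.map_coe, Multiset.prod_coe,
      map_list_prod, List.map_map]
    simp [Function.comp_def, Algebra.algebraMap_eq_smul_one]
  simp only [hzero, Matrix.zero_mul, norm_zero]
  exact ⟨0, le_rfl, 1, one_pos, fun t _ => by simp⟩

end MatrixODE

section FiniteDimensional

variable {E F : Type*} [NormedAddCommGroup E] [NormedSpace ℝ E] [FiniteDimensional ℝ E]
  [NormedAddCommGroup F] [NormedSpace ℝ F]

theorem LinearMap.exists_norm_le_of_finiteDimensional (T : E →ₗ[ℝ] F) :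
    ∃ c ≥ (0 : ℝ), ∀ x, ‖T x‖ ≤ c * ‖x‖ :=
  ⟨‖LinearMap.toContinuousLinearMap T‖, norm_nonneg _,
    fun x => (LinearMap.toContinuousLinearMap T).le_opNorm x⟩

theorem LinearMap.hasDerivAt_comp_of_finiteDimensional (T : E →ₗ[ℝ] F) {e : ℝ → E} {e' : E}
    {t : ℝ} (he : HasDerivAt e e' t) : HasDerivAt (fun s => T (e s)) (T e') t :=
  (LinearMap.toContinuousLinearMap T).hasFDerivAt.comp_hasDerivAt t he

theorem LinearMap.hasDerivAt_apply_self_of_finiteDimensional (b : E →ₗ[ℝ] E →ₗ[ℝ] F)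
    {e : ℝ → E} {e' : E} {t : ℝ} (he : HasDerivAt e e' t) :
    HasDerivAt (fun s => b (e s) (e s)) (b (e t) e' + b e' (e t)) t :=
  b.toContinuousBilinearMap.hasFDerivAt_of_bilinear he.hasFDerivAt he.hasFDerivAt
    |>.hasDerivAt.congr_deriv (by simp)

end FiniteDimensional

theorem hasDerivAt_mul_mul_ringInverse {R : Type*} [NormedRing R] [NormedAlgebra ℝ R]
    [CompleteSpace R] {a x : ℝ → R} {a' x' : R} {t : ℝ} (ha : HasDerivAt a a' t)
    (hx : HasDerivAt x x' t) (hu : IsUnit (a t)) :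
    HasDerivAt (fun s => a s * x s * Ring.inverse (a s))
      ((a' * x t + a t * x') * Ring.inverse (a t) -
        a t * x t * (Ring.inverse (a t) * a' * Ring.inverse (a t))) t := by
  obtain ⟨w, hw⟩ := hu
  have hinv := hasFDerivAt_ringInverse (𝕜 := ℝ) w
  rw [hw] at hinv
  refine HasDerivAt.congr_deriv ((ha.mul hx).mul (hinv.comp_hasDerivAt t ha)) ?_
  simp [← hw, sub_eq_add_neg]

section Frobenius

variable {n : ℕ}

theorem hasDerivAt_mul_mul_inv {a x : ℝ → Matrix (Fin n) (Fin n) ℝ}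
    {a' x' : Matrix (Fin n) (Fin n) ℝ} {t : ℝ} (ha : HasDerivAt a a' t)
    (hx : HasDerivAt x x' t) (hu : IsUnit (a t)) :
    HasDerivAt (fun s => a s * x s * (a s)⁻¹)
      ((a' * x t + a t * x') * (a t)⁻¹ - a t * x t * ((a t)⁻¹ * a' * (a t)⁻¹)) t := by
  let : NormedRing (Matrix (Fin n) (Fin n) ℝ) := Matrix.frobeniusNormedRing
  let : NormedAlgebra ℝ (Matrix (Fin n) (Fin n) ℝ) := Matrix.frobeniusNormedAlgebra
  have : CompleteSpace (Matrix (Fin n) (Fin n) ℝ) := FiniteDimensional.complete ℝ _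
  simp only [Matrix.nonsing_inv_eq_ringInverse]
  exact hasDerivAt_mul_mul_ringInverse ha hx hu

theorem fip_comm (A B : Matrix (Fin n) (Fin n) ℝ) : fip A B = fip B A := by
  rw [fip, fip, ← Matrix.trace_transpose, Matrix.transpose_mul, Matrix.transpose_transpose]

theorem fip_self (A : Matrix (Fin n) (Fin n) ℝ) : fip A A = ‖A‖ ^ 2 := by
  rw [Matrix.frobenius_norm_def, ← Real.sqrt_eq_rpow, Real.sq_sqrt (by positivity), fip,
    Matrix.trace, Finset.sum_comm]
  simp [Matrix.mul_apply, sq]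

theorem fip_sub_right (A B C : Matrix (Fin n) (Fin n) ℝ) :
    fip A (B - C) = fip A B - fip A C := by
  simp [fip, Matrix.mul_sub]

theorem fip_sub_left (A B C : Matrix (Fin n) (Fin n) ℝ) :
    fip (A - B) C = fip A C - fip B C := by
  simp [fip, Matrix.sub_mul]

theorem fip_smul_right (c : ℝ) (A B : Matrix (Fin n) (Fin n) ℝ) :
    fip A (c • B) = c * fip A B := by
  simp [fip]

theorem fip_smul_left (c : ℝ) (A B : Matrix (Fin n) (Fin n) ℝ) :
    fip (c • A) B = c * fip A B := by
  simp [fip]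

theorem norm_sq_le_of_mul_transpose_le {g : Matrix (Fin n) (Fin n) ℝ} {c : ℝ}
    (h : ((c • 1 : Matrix (Fin n) (Fin n) ℝ) - g * gᵀ).PosSemidef) : ‖g‖ ^ 2 ≤ c * n := by
  have ht := h.trace_nonneg
  rw [Matrix.trace_sub, Matrix.trace_smul, Matrix.trace_one, Matrix.trace_mul_comm,
    ← fip, fip_self] at ht
  simpa using ht

theorem norm_inv_sq_le_of_le_mul_transpose {g : Matrix (Fin n) (Fin n) ℝ} {c : ℝ} (hc : 0 < c)
    (hu : IsUnit g) (h : (g * gᵀ - c • (1 : Matrix (Fin n) (Fin n) ℝ)).PosSemidef) :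
    ‖g⁻¹‖ ^ 2 ≤ n / c := by
  have hdet : IsUnit g.det := (Matrix.isUnit_iff_isUnit_det g).mp hu
  have hT : gᵀ * (g⁻¹)ᵀ = 1 := by
    rw [← Matrix.transpose_mul, Matrix.nonsing_inv_mul _ hdet, Matrix.transpose_one]
  have ht := (h.mul_mul_conjTranspose_same g⁻¹).trace_nonneg
  have heq : g⁻¹ * (g * gᵀ - c • (1 : Matrix (Fin n) (Fin n) ℝ)) * (g⁻¹)ᴴ =
      1 - c • (g⁻¹ * (g⁻¹)ᵀ) := by
    rw [Matrix.conjTranspose_eq_transpose_of_trivial, Matrix.mul_sub, Matrix.sub_mul,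
      ← Matrix.mul_assoc, Matrix.nonsing_inv_mul _ hdet, Matrix.one_mul, hT]
    simp
  rw [heq, Matrix.trace_sub, Matrix.trace_smul, Matrix.trace_one, Matrix.trace_mul_comm,
    ← fip, fip_self] at ht
  rw [le_div_iff₀ hc]
  simp at ht
  linarith

/-- Weighting the Frobenius inner product by `(g gᵀ)⁻¹` keeps it coercive. -/
theorem norm_sq_le_mul_fip_mul_inv {g X : Matrix (Fin n) (Fin n) ℝ} {K : ℝ} (hu : IsUnit g)
    (hK : ‖g‖ ^ 2 ≤ K) : ‖X‖ ^ 2 ≤ K * fip X (X * (g * gᵀ)⁻¹) := by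
  have hdet : IsUnit g.det := (Matrix.isUnit_iff_isUnit_det g).mp hu
  have hT : (g⁻¹)ᵀ * gᵀ = 1 := by
    rw [← Matrix.transpose_mul, Matrix.mul_nonsing_inv _ hdet, Matrix.transpose_one]
  have hX : X * (g⁻¹)ᵀ * gᵀ = X := by rw [Matrix.mul_assoc, hT, Matrix.mul_one]
  have hfip : fip X (X * (g * gᵀ)⁻¹) = ‖X * (g⁻¹)ᵀ‖ ^ 2 := by
    rw [← fip_self, fip, fip, Matrix.mul_inv_rev, ← Matrix.transpose_nonsing_inv,
      Matrix.transpose_mul, Matrix.transpose_transpose, Matrix.mul_assoc g⁻¹,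
      Matrix.trace_mul_comm g⁻¹]
    simp only [Matrix.mul_assoc]
  have hle : ‖X‖ ≤ ‖X * (g⁻¹)ᵀ‖ * ‖g‖ := by
    have h := Matrix.frobenius_norm_mul (X * (g⁻¹)ᵀ) gᵀ
    rwa [hX, Matrix.frobenius_norm_transpose] at h
  rw [hfip]
  calc ‖X‖ ^ 2 ≤ (‖X * (g⁻¹)ᵀ‖ * ‖g‖) ^ 2 := by gcongr
    _ = ‖g‖ ^ 2 * ‖X * (g⁻¹)ᵀ‖ ^ 2 := by ring
    _ ≤ K * ‖X * (g⁻¹)ᵀ‖ ^ 2 := by gcongr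

theorem norm_mul_transpose_inv_le {g : Matrix (Fin n) (Fin n) ℝ} {K : ℝ} (hK : ‖g⁻¹‖ ^ 2 ≤ K) :
    ‖(g * gᵀ)⁻¹‖ ≤ K := by
  rw [Matrix.mul_inv_rev, ← Matrix.transpose_nonsing_inv]
  refine (Matrix.frobenius_norm_mul _ _).trans ?_
  rwa [Matrix.frobenius_norm_transpose, ← sq]

theorem norm_mul_mul_le {a b X : Matrix (Fin n) (Fin n) ℝ} {K : ℝ}
    (ha : ‖a‖ ^ 2 ≤ K) (hb : ‖b‖ ^ 2 ≤ K) : ‖a * X * b‖ ≤ K * ‖X‖ := by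
  have hab : ‖a‖ * ‖b‖ ≤ K := by nlinarith [sq_nonneg (‖a‖ - ‖b‖)]
  calc ‖a * X * b‖ ≤ ‖a * X‖ * ‖b‖ := Matrix.frobenius_norm_mul _ _
    _ ≤ ‖a‖ * ‖X‖ * ‖b‖ := by gcongr; exact Matrix.frobenius_norm_mul _ _
    _ = ‖a‖ * ‖b‖ * ‖X‖ := by ring
    _ ≤ K * ‖X‖ := by gcongr

theorem hasDerivAt_fip_apply_self
    (T : Matrix (Fin n) (Fin n) ℝ →ₗ[ℝ] Matrix (Fin n) (Fin n) ℝ)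
    (hsa : ∀ v w, fip (T v) w = fip v (T w)) {e : ℝ → Matrix (Fin n) (Fin n) ℝ}
    {e' : Matrix (Fin n) (Fin n) ℝ} {t : ℝ} (he : HasDerivAt e e' t) :
    HasDerivAt (fun s => fip (T (e s)) (e s)) (2 * fip (T (e t)) e') t := by
  let b : Matrix (Fin n) (Fin n) ℝ →ₗ[ℝ] Matrix (Fin n) (Fin n) ℝ →ₗ[ℝ] ℝ :=
    LinearMap.mk₂ ℝ (fun x y => fip (T x) y)
      (fun x y z => by simp [fip, Matrix.add_mul]) (fun c x y => by simp [fip])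
      (fun x y z => by simp [fip, Matrix.mul_add]) (fun c x y => by simp [fip])
  refine HasDerivAt.congr_deriv (b.hasDerivAt_apply_self_of_finiteDimensional he) ?_
  change fip (T (e t)) e' + fip (T e') (e t) = _
  rw [hsa e', fip_comm e']
  ring

end Frobenius

theorem le_mul_exp_of_hasDerivAt_le {V V' : ℝ → ℝ} {k : ℝ} (hV : ∀ t, HasDerivAt V (V' t) t)
    (hle : ∀ t, V' t ≤ -k * V t) {t : ℝ} (ht : 0 ≤ t) : V t ≤ V 0 * Real.exp (-k * t) := by
  have hd : ∀ s, HasDerivAt (fun s => V s * Real.exp (k * s))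
      (V' s * Real.exp (k * s) + V s * (Real.exp (k * s) * k)) s := by
    intro s
    have h := ((hasDerivAt_id s).const_mul k).exp
    simp only [id, mul_one] at h
    exact (hV s).mul h
  have hanti : Antitone fun s => V s * Real.exp (k * s) := by
    refine antitone_of_deriv_nonpos (fun s => (hd s).differentiableAt) fun s => ?_
    rw [(hd s).deriv]
    nlinarith [hle s, Real.exp_pos (k * s)]
  have h := hanti ht
  simp only [mul_zero, Real.exp_zero, mul_one] at h
  rw [neg_mul, Real.exp_neg, ← div_eq_mul_inv, le_div_iff₀ (Real.exp_pos _)]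
  exact h

/-- Solutions of the second-order matrix system `x' = w`, `w' = Kp x + Kd w` decay exponentially
when its companion matrix is Hurwitz. -/
theorem expDecay_of_companion_hurwitz {n : ℕ} (Kp Kd : Matrix (Fin n) (Fin n) ℝ)
    (hHurwitz : ∀ μ : ℂ,
      ((Matrix.fromBlocks (0 : Matrix (Fin n) (Fin n) ℝ) 1 Kp Kd).map
        (Complex.ofReal)).charpoly.IsRoot μ → μ.re < 0)
    {x w : ℝ → Matrix (Fin n) (Fin n) ℝ} (hx : ∀ t, HasDerivAt x (w t) t)
    (hw : ∀ t, HasDerivAt w (Kp * x t + Kd * w t) t) {N c : ℝ} (hN : 0 ≤ N) (hc : 0 ≤ c)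
    (hx0 : ‖x 0‖ ≤ c * N) (hw0 : ‖w 0‖ ≤ c * N) :
    ExpDecay N (fun t => ‖x t‖) ∧ ExpDecay N fun t => ‖w t‖ := by
  let J : Matrix (Fin n) (Fin n) ℝ × Matrix (Fin n) (Fin n) ℝ →ₗ[ℝ]
      Matrix (Fin n ⊕ Fin n) (Fin n) ℂ :=
    { toFun := fun p => (Matrix.fromRows p.1 p.2).map Complex.ofReal
      map_add' := fun p q => by ext (i | i) j <;> simp
      map_smul' := fun a p => by ext (i | i) j <;> simp }
  let R₁ : Matrix (Fin n ⊕ Fin n) (Fin n) ℂ →ₗ[ℝ] Matrix (Fin n) (Fin n) ℝ :=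
    { toFun := fun z => z.toRows₁.map Complex.re
      map_add' := fun p q => by ext i j; simp [Matrix.toRows₁]
      map_smul' := fun a p => by ext i j; simp [Matrix.toRows₁] }
  let R₂ : Matrix (Fin n ⊕ Fin n) (Fin n) ℂ →ₗ[ℝ] Matrix (Fin n) (Fin n) ℝ :=
    { toFun := fun z => z.toRows₂.map Complex.re
      map_add' := fun p q => by ext i j; simp [Matrix.toRows₂]
      map_smul' := fun a p => by ext i j; simp [Matrix.toRows₂] }
  obtain ⟨cJ, hcJ, hJ⟩ := LinearMap.exists_norm_le_of_finiteDimensional J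
  obtain ⟨r₁, hr₁, hR₁⟩ := LinearMap.exists_norm_le_of_finiteDimensional R₁
  obtain ⟨r₂, hr₂, hR₂⟩ := LinearMap.exists_norm_le_of_finiteDimensional R₂
  have hz : ∀ t, HasDerivAt (fun s => J (x s, w s))
      ((Matrix.fromBlocks (0 : Matrix (Fin n) (Fin n) ℝ) 1 Kp Kd).map (Complex.ofReal) *
        J (x t, w t)) t := by
    intro t
    have h := LinearMap.hasDerivAt_comp_of_finiteDimensional J ((hx t).prodMk (hw t))
    refine HasDerivAt.congr_deriv h ?_
    change (Matrix.fromRows (w t) (Kp * x t + Kd * w t)).map Complex.ofReal =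
      (Matrix.fromBlocks (0 : Matrix (Fin n) (Fin n) ℝ) 1 Kp Kd).map Complex.ofReal *
        (Matrix.fromRows (x t) (w t)).map Complex.ofReal
    have hmap := Matrix.map_mul (L := Matrix.fromBlocks (0 : Matrix (Fin n) (Fin n) ℝ) 1 Kp Kd)
      (M := Matrix.fromRows (x t) (w t)) (f := Complex.ofRealHom)
    refine Eq.trans ?_ hmap
    rw [Matrix.fromBlocks_mul_fromRows, Matrix.zero_mul, Matrix.one_mul, zero_add]
    rfl
  have hz0 : ‖J (x 0, w 0)‖ ≤ cJ * c * N := by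
    refine (hJ _).trans ?_
    rw [mul_assoc]
    gcongr
    exact max_le hx0 hw0
  have hdec := expDecay_of_hurwitz hN (by positivity) _ hHurwitz hz hz0
  exact ⟨(hdec.const_mul hr₁).mono fun t _ => hR₁ (J (x t, w t)),
    (hdec.const_mul hr₂).mono fun t _ => hR₂ (J (x t, w t))⟩

/-- The transversal error decays exponentially, with `fip (H e) e` as a Lyapunov function. -/
theorem expDecay_transversal {n : ℕ}
    (𝔤 : Submodule ℝ (Matrix (Fin n) (Fin n) ℝ))
    (Pperp : Matrix (Fin n) (Fin n) ℝ →ₗ[ℝ] Matrix (Fin n) (Fin n) ℝ)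
    (hPperp : ∀ x, Pperp x ∈ mperp 𝔤 ∧ x - Pperp x ∈ 𝔤)
    (H : Matrix (Fin n) (Fin n) ℝ →ₗ[ℝ] Matrix (Fin n) (Fin n) ℝ)
    (hsa : ∀ v w, fip (H v) w = fip v (H w))
    (hHperp : ∀ y ∈ mperp 𝔤, H y ∈ mperp 𝔤)
    {lmin lmax : ℝ} (hlmin : 0 < lmin) (hlmax : 0 < lmax)
    (hbound : ∀ y ∈ mperp 𝔤,
      lmin * ‖y‖ ^ 2 ≤ fip (H y) y ∧ fip (H y) y ≤ lmax * ‖y‖ ^ 2)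
    {α K : ℝ} (hα : 0 < α) (hKpos : 0 < K) {g : ℝ → Matrix (Fin n) (Fin n) ℝ}
    (hu : ∀ t, IsUnit (g t)) (hK : ∀ t, ‖g t‖ ^ 2 ≤ K)
    {e : ℝ → Matrix (Fin n) (Fin n) ℝ} (he : ∀ t, e t ∈ mperp 𝔤)
    (he' : ∀ t, HasDerivAt e (-α • Pperp (H (e t) * (g t * (g t)ᵀ)⁻¹)) t) :
    ExpDecay ‖e 0‖ fun t => ‖e t‖ := by
  have hV := fun t => hasDerivAt_fip_apply_self H hsa (he' t)
  set k := 2 * α * lmin / K with hk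
  have hkpos : 0 < k := by positivity
  have hle : ∀ t, 2 * fip (H (e t)) (-α • Pperp (H (e t) * (g t * (g t)ᵀ)⁻¹)) ≤
      -k * fip (H (e t)) (e t) := by
    intro t
    set X := H (e t) with hX
    set Q := X * (g t * (g t)ᵀ)⁻¹
    have hproj : fip X (Pperp Q) = fip X Q := by
      have h : fip (Q - Pperp Q) X = 0 := hHperp _ (he t) _ (hPperp Q).2
      rw [fip_comm, fip_sub_right] at h
      linarith
    have hcoer : ‖X‖ ^ 2 ≤ K * fip X Q := norm_sq_le_mul_fip_mul_inv (hu t) (hK t)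
    have hXnorm : lmin * fip X (e t) ≤ ‖X‖ ^ 2 := by
      have hsq : 0 ≤ fip (X - lmin • e t) (X - lmin • e t) := by
        rw [fip_self]
        positivity
      rw [fip_sub_left, fip_sub_right, fip_sub_right, fip_smul_left, fip_smul_left,
        fip_smul_right, fip_smul_right, fip_self, fip_self, fip_comm (e t) X] at hsq
      nlinarith [(hbound _ (he t)).1]
    rw [fip_smul_right, hproj]
    have hmain : lmin * fip X (e t) / K ≤ fip X Q := by
      rw [div_le_iff₀ hKpos]
      linarith
    have hkeq : k * fip X (e t) = 2 * α * (lmin * fip X (e t) / K) := by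
      rw [hk]
      ring
    nlinarith
  refine ⟨√(lmax / lmin), Real.sqrt_nonneg _, k / 2, by positivity, fun t ht => ?_⟩
  have hdecay := le_mul_exp_of_hasDerivAt_le hV hle ht
  have h0 := (hbound _ (he 0)).2
  have ht' := (hbound _ (he t)).1
  refine (sq_le_sq₀ (by positivity) (by positivity)).mp ?_
  have hexp : Real.exp (-(k / 2) * t) ^ 2 = Real.exp (-k * t) := by
    rw [← Real.exp_nat_mul]
    congr 1
    push_cast
    ring
  rw [mul_pow, mul_pow, Real.sq_sqrt (by positivity), hexp]
  have hchain : lmin * ‖e t‖ ^ 2 ≤ lmax * ‖e 0‖ ^ 2 * Real.exp (-k * t) :=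
    ht'.trans (hdecay.trans (by gcongr))
  have hdiv : lmax / lmin * Real.exp (-k * t) * ‖e 0‖ ^ 2 =
      lmax * ‖e 0‖ ^ 2 * Real.exp (-k * t) / lmin := by
    ring
  rw [hdiv, le_div_iff₀ hlmin]
  linarith

/-- **Theorem 2**: under the paper's Assumptions 1 and 2, the PD-like feedback law (8) with
Hurwitz gain block matrix `[[0, I], [Kp, Kd]]` renders the linearized tracking-error
dynamics (7) (transversal, parallel, and Lie-algebra components) exponentially stable
to zero. -/
theorem linearized_error_dynamics_exponentially_stable {n : ℕ}
    (𝔤 : Submodule ℝ (Matrix (Fin n) (Fin n) ℝ))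
    (Pperp Ppar : Matrix (Fin n) (Fin n) ℝ →ₗ[ℝ] Matrix (Fin n) (Fin n) ℝ)
    (hPperp : ∀ x, Pperp x ∈ mperp 𝔤 ∧ x - Pperp x ∈ 𝔤)
    (hPpar : ∀ x, Ppar x ∈ 𝔤 ∧ x - Ppar x ∈ mperp 𝔤)
    (H : Matrix (Fin n) (Fin n) ℝ →ₗ[ℝ] Matrix (Fin n) (Fin n) ℝ)
    (hsa : ∀ v w, fip (H v) w = fip v (H w))
    (hker : ∀ v ∈ 𝔤, H v = 0)
    (hHperp : ∀ y ∈ mperp 𝔤, H y ∈ mperp 𝔤)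
    (lmin lmax : ℝ) (hlmin : 0 < lmin) (hlminmax : lmin ≤ lmax)
    (hbound : ∀ y ∈ mperp 𝔤,
      lmin * ‖y‖ ^ 2 ≤ fip (H y) y ∧ fip (H y) y ≤ lmax * ‖y‖ ^ 2)
    (α : ℝ) (hα : 0 < α)
    (c₁ c₂ : ℝ) (hc₁ : 0 < c₁) (hc₁₂ : c₁ ≤ c₂)
    (g₀ ξ₀ : ℝ → Matrix (Fin n) (Fin n) ℝ)
    (hg₀unit : ∀ t, IsUnit (g₀ t))
    (hg₀bnd : ∀ t, (g₀ t * (g₀ t)ᵀ - c₁ • 1).PosSemidef ∧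
      ((c₂ • 1 : Matrix (Fin n) (Fin n) ℝ) - g₀ t * (g₀ t)ᵀ).PosSemidef)
    (hg₀' : ∀ t, HasDerivAt g₀ (g₀ t * ξ₀ t) t)
    (hξ₀ : ∀ t, ξ₀ t ∈ 𝔤)
    (hconj : ∀ t, ∀ v ∈ 𝔤, g₀ t * v * (g₀ t)⁻¹ ∈ 𝔤)
    (Kp Kd : Matrix (Fin n) (Fin n) ℝ)
    (hHurwitz : ∀ μ : ℂ,
      ((Matrix.fromBlocks (0 : Matrix (Fin n) (Fin n) ℝ) 1 Kp Kd).map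
        (Complex.ofReal)).charpoly.IsRoot μ → μ.re < 0)
    (A : ℝ → (Matrix (Fin n) (Fin n) ℝ →ₗ[ℝ] Matrix (Fin n) (Fin n) ℝ))
    (eperp epar ξt W W' Y v : ℝ → Matrix (Fin n) (Fin n) ℝ)
    (heperp : ∀ t, eperp t ∈ mperp 𝔤)
    (hepar : ∀ t, epar t ∈ 𝔤)
    (hξt : ∀ t, ξt t ∈ 𝔤)
    (hW : ∀ t, W t = -α • Ppar (H (eperp t) * (g₀ t * (g₀ t)ᵀ)⁻¹))
    (hW' : ∀ t, HasDerivAt W (W' t) t)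
    (hY : ∀ t, Y t = (g₀ t)⁻¹ *
      (-(W' t) + Kp * epar t + Kd * (g₀ t * ξt t * (g₀ t)⁻¹ + W t)) * g₀ t)
    (hv : ∀ t, v t = ξt t * ξ₀ t - ξ₀ t * ξt t + Y t - A t (ξt t))
    (heperp' : ∀ t, HasDerivAt eperp (-α • Pperp (H (eperp t) * (g₀ t * (g₀ t)ᵀ)⁻¹)) t)
    (hepar' : ∀ t, HasDerivAt epar (g₀ t * ξt t * (g₀ t)⁻¹ + W t) t)
    (hξt' : ∀ t, HasDerivAt ξt (A t (ξt t) + v t) t) :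
    ∃ C > (0 : ℝ), ∃ β > (0 : ℝ), ∀ t : ℝ, 0 ≤ t →
      ‖eperp t‖ + ‖epar t‖ + ‖ξt t‖ ≤
        C * Real.exp (-β * t) * (‖eperp 0‖ + ‖epar 0‖ + ‖ξt 0‖) := by
  have hc₂ : 0 < c₂ := hc₁.trans_le hc₁₂
  obtain ⟨K, hKpos, hK, hKinv⟩ : ∃ K > (0 : ℝ), (∀ t, ‖g₀ t‖ ^ 2 ≤ K) ∧
      ∀ t, ‖(g₀ t)⁻¹‖ ^ 2 ≤ K := by
    have h₁ : 0 ≤ c₂ * n := by positivity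
    have h₂ : 0 ≤ n / c₁ := by positivity
    exact ⟨c₂ * n + n / c₁ + 1, by positivity,
      fun t => (norm_sq_le_of_mul_transpose_le (hg₀bnd t).2).trans (by linarith),
      fun t => (norm_inv_sq_le_of_le_mul_transpose hc₁ (hg₀unit t) (hg₀bnd t).1).trans
        (by linarith)⟩
  set N := ‖eperp 0‖ + ‖epar 0‖ + ‖ξt 0‖ with hN_def
  have hN : 0 ≤ N := by positivity
  have hperp0 : ‖eperp 0‖ ≤ N := by
    linarith [norm_nonneg (epar 0), norm_nonneg (ξt 0)]
  have hpar0 : ‖epar 0‖ ≤ N := by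
    linarith [norm_nonneg (eperp 0), norm_nonneg (ξt 0)]
  have hξ0 : ‖ξt 0‖ ≤ N := by
    linarith [norm_nonneg (epar 0), norm_nonneg (eperp 0)]
  have hdec_perp : ExpDecay N fun t => ‖eperp t‖ :=
    (expDecay_transversal 𝔤 Pperp hPperp H hsa hHperp hlmin
      (hlmin.trans_le hlminmax) hbound hα hKpos hg₀unit hK heperp heperp').of_le hperp0
  obtain ⟨cH, hcH, hH⟩ := LinearMap.exists_norm_le_of_finiteDimensional H
  obtain ⟨cP, hcP, hP⟩ := LinearMap.exists_norm_le_of_finiteDimensional Ppar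
  have hWle : ∀ t, ‖W t‖ ≤ α * (cP * (cH * K)) * ‖eperp t‖ := by
    intro t
    rw [hW, norm_smul, norm_neg, Real.norm_of_nonneg hα.le]
    calc α * ‖Ppar (H (eperp t) * (g₀ t * (g₀ t)ᵀ)⁻¹)‖
        ≤ α * (cP * (cH * ‖eperp t‖ * K)) := by
          gcongr
          refine (hP _).trans ?_
          gcongr
          refine (Matrix.frobenius_norm_mul _ _).trans ?_
          gcongr
          · exact hH _
          · exact norm_mul_transpose_inv_le (hKinv t)
      _ = _ := by ring
  have hcW : 0 ≤ α * (cP * (cH * K)) := by positivity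
  set cW := α * (cP * (cH * K))
  set w : ℝ → Matrix (Fin n) (Fin n) ℝ := fun t => g₀ t * ξt t * (g₀ t)⁻¹ + W t with hw_def
  have hw' : ∀ t, HasDerivAt w (Kp * epar t + Kd * w t) t := by
    intro t
    have hdet : IsUnit (g₀ t).det := (Matrix.isUnit_iff_isUnit_det _).mp (hg₀unit t)
    refine HasDerivAt.congr_deriv
      ((hasDerivAt_mul_mul_inv (hg₀' t) (hξt' t) (hg₀unit t)).add (hW' t)) ?_
    have hYconj : g₀ t * Y t * (g₀ t)⁻¹ = -(W' t) + Kp * epar t + Kd * w t := by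
      rw [hY]
      simp only [Matrix.mul_assoc, Matrix.mul_nonsing_inv _ hdet, Matrix.mul_one]
      rw [← Matrix.mul_assoc, Matrix.mul_nonsing_inv _ hdet, Matrix.one_mul]
      simp only [hw_def, Matrix.mul_assoc]
    have hcancel : (g₀ t)⁻¹ * (g₀ t * ξ₀ t) = ξ₀ t := by
      rw [← Matrix.mul_assoc, Matrix.nonsing_inv_mul _ hdet, Matrix.one_mul]
    have hsum : A t (ξt t) + v t = ξt t * ξ₀ t - ξ₀ t * ξt t + Y t := by
      rw [hv]
      abel
    have hrhs : Kp * epar t + Kd * w t = g₀ t * Y t * (g₀ t)⁻¹ + W' t := by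
      rw [hYconj]
      abel
    rw [hsum, hcancel, hrhs]
    noncomm_ring
  have hconj_le : ∀ t, ‖g₀ t * ξt t * (g₀ t)⁻¹‖ ≤ K * ‖ξt t‖ :=
    fun t => norm_mul_mul_le (hK t) (hKinv t)
  have hw0 : ‖w 0‖ ≤ (1 + K + cW) * N := by
    calc ‖w 0‖ ≤ ‖g₀ 0 * ξt 0 * (g₀ 0)⁻¹‖ + ‖W 0‖ := norm_add_le _ _
      _ ≤ K * N + cW * N := by
        gcongr
        · exact (hconj_le 0).trans (by gcongr)
        · exact (hWle 0).trans (by gcongr)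
      _ ≤ (1 + K + cW) * N := by linarith
  have hx0 : ‖epar 0‖ ≤ (1 + K + cW) * N := by
    nlinarith [mul_nonneg hKpos.le hN, mul_nonneg hcW hN]
  obtain ⟨hdec_par, hdec_w⟩ := expDecay_of_companion_hurwitz Kp Kd hHurwitz hepar' hw' hN
    (by positivity) hx0 hw0
  have hdec_ξ : ExpDecay N fun t => ‖ξt t‖ := by
    refine ((hdec_w.add hN (hdec_perp.const_mul hcW)).const_mul hKpos.le).mono fun t _ => ?_
    have hdet : IsUnit (g₀ t).det := (Matrix.isUnit_iff_isUnit_det _).mp (hg₀unit t)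
    have hξ : ξt t = (g₀ t)⁻¹ * (w t - W t) * g₀ t := by
      simp only [hw_def, add_sub_cancel_right, Matrix.mul_assoc, Matrix.nonsing_inv_mul _ hdet,
        Matrix.mul_one]
      rw [← Matrix.mul_assoc, Matrix.nonsing_inv_mul _ hdet, Matrix.one_mul]
    calc ‖ξt t‖ ≤ K * ‖w t - W t‖ := by
          conv_lhs => rw [hξ]
          exact norm_mul_mul_le (hKinv t) (hK t)
      _ ≤ K * (‖w t‖ + cW * ‖eperp t‖) := by
          gcongr
          exact (norm_sub_le _ _).trans (by gcongr; exact hWle t)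
  obtain ⟨C, hC, β, hβ, hb⟩ := (hdec_perp.add hN hdec_par).add hN hdec_ξ
  refine ⟨C + 1, by positivity, β, hβ, fun t ht => (hb t ht).trans ?_⟩
  gcongr
  linarith
end

section
/- Let V : Matrix (Fin 3) (Fin 3) ℝ → ℝ be defined by V(X) = (1/4)·‖Xᵀ·X − I‖², where ‖·‖ is the Frobenius norm. Then the second derivative of V at the identity matrix I is given by D²V(I)(Y, Z) = ⟨Y + Yᵀ, Z⟩ for all Y, Z ∈ Matrix (Fin 3) (Fin 3) ℝ, where ⟨A,B⟩ = trace(AᵀB). Consequently, D²V(I)(Y, Y) = 2·‖Y‖² for every symmetric Y, and D²V(I)(Y, Y) = 0 for every skew-symmetric Y; in particular the Hessian of V at I, restricted to the symmetric matrices (the orthogonal complement of so(3)), is positive definite with smallest and largest eigenvalue both equal to 2. -/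
open scoped Matrix

attribute [local instance] Matrix.frobeniusNormedAddCommGroup Matrix.frobeniusNormedSpace

/-- The embedding function `V(X) = (1/4) ‖Xᵀ X - I‖²` (Frobenius norm) used to stably
extend the rigid body attitude dynamics from `SO(3)` to `ℝ^{3×3}`. -/
noncomputable def Vemb (X : Matrix (Fin 3) (Fin 3) ℝ) : ℝ :=
  (1 / 4 : ℝ) * ‖Xᵀ * X - 1‖ ^ 2

theorem frobenius_norm_sq_eq_trace {m n : Type*} [Fintype m] [Fintype n]
    (A : Matrix m n ℝ) : ‖A‖ ^ 2 = (Aᵀ * A).trace := by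
  rw [Matrix.frobenius_norm_def, ← Real.sqrt_eq_rpow, Real.sq_sqrt (by positivity),
    Finset.sum_comm]
  simp [Matrix.trace, Matrix.mul_apply, ← pow_two]

/-- Stated for abstract normed spaces so that it applies to matrices, whose topology instance does
not syntactically come from the Frobenius norm. -/
theorem ContinuousLinearMap.hasFDerivAt_comp_curried {E F G H : Type*}
    [NormedAddCommGroup E] [NormedSpace ℝ E]
    [NormedAddCommGroup F] [NormedSpace ℝ F] [NormedAddCommGroup G] [NormedSpace ℝ G]
    [NormedAddCommGroup H] [NormedSpace ℝ H] (L : F →L[ℝ] G →L[ℝ] H)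
    {f : E → F} {f' : E →L[ℝ] F} {x : E} (hf : HasFDerivAt f f' x) :
    HasFDerivAt (fun y => L (f y)) (L.comp f') x :=
  L.hasFDerivAt.comp x hf

/-- The linear functional `Z ↦ trace (A * Z)`, as a continuous linear function of `A`. -/
noncomputable def traceMulCLM (n : Type*) [Fintype n] :
    Matrix n n ℝ →L[ℝ] Matrix n n ℝ →L[ℝ] ℝ :=
  LinearMap.toContinuousBilinearMap
    ((LinearMap.mul ℝ (Matrix n n ℝ)).compr₂ (Matrix.traceLinearMap n ℝ ℝ))

theorem traceMulCLM_apply {n : Type*} [Fintype n] (A Z : Matrix n n ℝ) :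
    traceMulCLM n A Z = (A * Z).trace := rfl

/-- Matrix transposition as a continuous linear map. -/
noncomputable def transposeCLM (n : Type*) [Fintype n] : Matrix n n ℝ →L[ℝ] Matrix n n ℝ :=
  LinearMap.toContinuousLinearMap (Matrix.transposeLinearEquiv n n ℝ ℝ).toLinearMap

/-- Matrix multiplication as a continuous bilinear map. -/
noncomputable def matMulCLM (n : Type*) [Fintype n] :
    Matrix n n ℝ →L[ℝ] Matrix n n ℝ →L[ℝ] Matrix n n ℝ :=
  LinearMap.toContinuousBilinearMap (LinearMap.mul ℝ (Matrix n n ℝ))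

theorem hasFDerivAt_transpose_mul_self_sub_one {n : Type*} [Fintype n] [DecidableEq n]
    (X : Matrix n n ℝ) :
    HasFDerivAt (fun X : Matrix n n ℝ => Xᵀ * X - 1)
      (((matMulCLM _).precompR _ Xᵀ (.id ℝ _)) + (matMulCLM _).precompL _ (transposeCLM _) X) X :=
  ((matMulCLM n).hasFDerivAt_of_bilinear (transposeCLM n).hasFDerivAt
    (hasFDerivAt_id X)).sub_const 1

theorem hasFDerivAt_Vemb (X : Matrix (Fin 3) (Fin 3) ℝ) :
    HasFDerivAt Vemb (traceMulCLM (Fin 3) ((Xᵀ * X - 1) * Xᵀ)) X := by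
  have hV : Vemb = fun X => (1 / 4 : ℝ) * traceMulCLM (Fin 3) (Xᵀ * X - 1) (Xᵀ * X - 1) := by
    ext X
    have hS : (Xᵀ * X - 1)ᵀ = Xᵀ * X - 1 := by simp
    rw [Vemb, frobenius_norm_sq_eq_trace, traceMulCLM_apply, hS]
  rw [hV]
  refine (((traceMulCLM (Fin 3)).hasFDerivAt_of_bilinear
    (hasFDerivAt_transpose_mul_self_sub_one X)
    (hasFDerivAt_transpose_mul_self_sub_one X)).const_mul (1 / 4 : ℝ)).congr_fderiv ?_
  ext Z
  set S := Xᵀ * X - 1 with hS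
  have hSt : Sᵀ = S := by simp [hS]
  have h1 : ((Zᵀ * X) * S).trace = (S * (Xᵀ * Z)).trace := by
    rw [← Matrix.trace_transpose]; simp [Matrix.transpose_mul, hSt]
  have h2 : (S * (Zᵀ * X)).trace = (S * (Xᵀ * Z)).trace := by
    rw [Matrix.trace_mul_comm, h1]
  have h3 : ((Xᵀ * Z) * S).trace = (S * (Xᵀ * Z)).trace := Matrix.trace_mul_comm _ _
  change (1 / 4 : ℝ) * ((S * (Xᵀ * Z + Zᵀ * X)).trace + ((Xᵀ * Z + Zᵀ * X) * S).trace) =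
    (S * Xᵀ * Z).trace
  rw [mul_add S, add_mul, Matrix.trace_add, Matrix.trace_add, h1, h2, h3, mul_assoc S]
  ring

theorem fderiv_fderiv_Vemb_one (Y Z : Matrix (Fin 3) (Fin 3) ℝ) :
    fderiv ℝ (fderiv ℝ Vemb) 1 Y Z = ((Y + Yᵀ)ᵀ * Z).trace := by
  have hD : fderiv ℝ Vemb = fun X => traceMulCLM (Fin 3) (matMulCLM (Fin 3) (Xᵀ * X - 1) Xᵀ) :=
    funext fun X => (hasFDerivAt_Vemb X).fderiv
  have h := ContinuousLinearMap.hasFDerivAt_comp_curried (traceMulCLM (Fin 3))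
    ((matMulCLM (Fin 3)).hasFDerivAt_of_bilinear (hasFDerivAt_transpose_mul_self_sub_one 1)
      (transposeCLM (Fin 3)).hasFDerivAt)
  rw [hD]
  refine (congrArg (fun L => L Y Z) h.fderiv).trans ?_
  change (((1ᵀ * 1 - 1) * Yᵀ + (1ᵀ * Y + Yᵀ * 1) * 1ᵀ) * Z).trace = _
  simp [add_comm]

/-- Condition (A-iii) of the paper's Assumption 1 for the rigid body attitude system: the
second derivative of `V` at the identity is `D²V(I)(Y, Z) = ⟨Y + Yᵀ, Z⟩ = trace((Y + Yᵀ)ᵀ Z)`.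
Consequently `D²V(I)(Y, Y) = 2‖Y‖²` for symmetric `Y` and `D²V(I)(Y, Y) = 0` for
skew-symmetric `Y`; the Hessian of `V` at `I` restricted to the symmetric matrices (the
orthogonal complement of `so(3)`) is positive definite, with smallest and largest
eigenvalues both equal to `2`. -/
theorem Vemb_hessian_at_identity :
    (∀ Y Z : Matrix (Fin 3) (Fin 3) ℝ,
        fderiv ℝ (fderiv ℝ Vemb) 1 Y Z = ((Y + Yᵀ)ᵀ * Z).trace) ∧
    (∀ Y : Matrix (Fin 3) (Fin 3) ℝ, Y.IsSymm →
        fderiv ℝ (fderiv ℝ Vemb) 1 Y Y = 2 * ‖Y‖ ^ 2) ∧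
    (∀ Y : Matrix (Fin 3) (Fin 3) ℝ, Yᵀ = -Y →
        fderiv ℝ (fderiv ℝ Vemb) 1 Y Y = 0) := by
  refine ⟨fderiv_fderiv_Vemb_one, fun Y hY => ?_, fun Y hY => ?_⟩
  · rw [fderiv_fderiv_Vemb_one, frobenius_norm_sq_eq_trace, hY.eq, Matrix.transpose_add, hY.eq,
      add_mul, Matrix.trace_add, two_mul]
  · simp [fderiv_fderiv_Vemb_one, hY]
end
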